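/- Let 𝔤 be a real Lie algebra of finite dimension n ≥ 3 whose derived ideal 𝔤¹ = [𝔤,𝔤] is 1-dimensional and contained in the center Z(𝔤), say 𝔤¹ = span(Z) for some nonzero central Z, and let ω : 𝔤 × 𝔤 → ℝ be the skew-symmetric bilinear form determined by [X,Y] = ω(X,Y)·Z for all X, Y ∈ 𝔤. Then for every linear functional F ∈ 𝔤*: the rank of the Kirillov form B_F is 0 if F(Z) = 0, and equals the rank of ω if F(Z) ≠ 0. In particular 𝔤 is an MD-algebra whose maximal Kirillov-form rank equals the rank of ω. -/

import Mathlib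

/-- The Kirillov form associated to a linear functional `F` on a real Lie algebra `L`:
the skew-symmetric bilinear form `B_F(X, Y) = F ⁅X, Y⁆`, bundled as a linear map
`L →ₗ[ℝ] L →ₗ[ℝ] ℝ`. -/
def kirillovForm {L : Type*} [LieRing L] [LieAlgebra ℝ L] (F : Module.Dual ℝ L) :
    L →ₗ[ℝ] L →ₗ[ℝ] ℝ :=
  LinearMap.mk₂ ℝ (fun X Y => F ⁅X, Y⁆)
    (fun X X' Y => by simp)
    (fun c X Y => by simp)
    (fun X Y Y' => by simp)
    (fun c X Y => by simp)

/-- The rank of the Kirillov form `B_F`. -/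
noncomputable def kirillovRank {L : Type*} [LieRing L] [LieAlgebra ℝ L]
    (F : Module.Dual ℝ L) : ℕ :=
  Module.finrank ℝ (LinearMap.range (kirillovForm F))

/-- A real Lie algebra is an MD-algebra if all Kirillov forms `B_F` of nonzero rank have the
same rank. -/
def IsMDAlgebra (L : Type*) [LieRing L] [LieAlgebra ℝ L] : Prop :=
  ∀ F G : Module.Dual ℝ L, kirillovRank F ≠ 0 → kirillovRank G ≠ 0 →
    kirillovRank F = kirillovRank G

theorem kirillovForm_eq_smul {L : Type*} [LieRing L] [LieAlgebra ℝ L] {Z : L}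
    {ω : L →ₗ[ℝ] L →ₗ[ℝ] ℝ} (hbr : ∀ X Y : L, ⁅X, Y⁆ = ω X Y • Z) (F : Module.Dual ℝ L) :
    kirillovForm F = F Z • ω := by
  ext X Y
  simp [kirillovForm, hbr, mul_comm]

theorem kirillovRank_eq_zero {L : Type*} [LieRing L] [LieAlgebra ℝ L] {Z : L}
    {ω : L →ₗ[ℝ] L →ₗ[ℝ] ℝ} (hbr : ∀ X Y : L, ⁅X, Y⁆ = ω X Y • Z) {F : Module.Dual ℝ L}
    (hF : F Z = 0) : kirillovRank F = 0 := by
  rw [kirillovRank, kirillovForm_eq_smul hbr, hF, zero_smul, LinearMap.range_zero, finrank_bot]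

theorem kirillovRank_eq_finrank_range {L : Type*} [LieRing L] [LieAlgebra ℝ L] {Z : L}
    {ω : L →ₗ[ℝ] L →ₗ[ℝ] ℝ} (hbr : ∀ X Y : L, ⁅X, Y⁆ = ω X Y • Z) {F : Module.Dual ℝ L}
    (hF : F Z ≠ 0) : kirillovRank F = Module.finrank ℝ (LinearMap.range ω) := by
  rw [kirillovRank, kirillovForm_eq_smul hbr, LinearMap.range_smul _ _ hF]

/-- Let `𝔤` be a real Lie algebra of finite dimension `n ≥ 3` whose derived
ideal is spanned by a nonzero central element `Z`, and let `ω` be the skew-symmetric bilinear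
form with `⁅X,Y⁆ = ω X Y • Z`. Then for every `F` in the dual: `B_F` has rank `0` if
`F Z = 0`, and rank equal to the rank of `ω` if `F Z ≠ 0`; in particular `𝔤` is an MD-algebra
whose maximal Kirillov-form rank is the rank of `ω`. -/
theorem kirillovRank_of_derived_central_span
    {L : Type*} [LieRing L] [LieAlgebra ℝ L] [Module.Finite ℝ L]
    (n : ℕ) (hn : 3 ≤ n) (hdim : Module.finrank ℝ L = n)
    (Z : L) (hZ0 : Z ≠ 0) (hZc : Z ∈ LieAlgebra.center ℝ L)
    (hder : (LieAlgebra.derivedSeries ℝ L 1 : Submodule ℝ L) = Submodule.span ℝ {Z})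
    (ω : L →ₗ[ℝ] L →ₗ[ℝ] ℝ) (hskew : ∀ X : L, ω X X = 0)
    (hbr : ∀ X Y : L, ⁅X, Y⁆ = ω X Y • Z) :
    (∀ F : Module.Dual ℝ L,
        (F Z = 0 → kirillovRank F = 0) ∧
        (F Z ≠ 0 → kirillovRank F = Module.finrank ℝ (LinearMap.range ω))) ∧
      IsMDAlgebra L ∧
      IsGreatest (Set.range fun F : Module.Dual ℝ L => kirillovRank F)
        (Module.finrank ℝ (LinearMap.range ω)) := by
  have eq_rank {F : Module.Dual ℝ L} (hF : kirillovRank F ≠ 0) :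
      kirillovRank F = Module.finrank ℝ (LinearMap.range ω) :=
    kirillovRank_eq_finrank_range hbr fun h => hF (kirillovRank_eq_zero hbr h)
  refine ⟨fun F => ⟨kirillovRank_eq_zero hbr, kirillovRank_eq_finrank_range hbr⟩,
    fun F G hF hG => (eq_rank hF).trans (eq_rank hG).symm, ?_, ?_⟩
  · obtain ⟨F, hF⟩ : ∃ F : Module.Dual ℝ L, F Z ≠ 0 := by
      contrapose! hZ0
      exact (Module.forall_dual_apply_eq_zero_iff ℝ Z).mp hZ0
    exact ⟨F, kirillovRank_eq_finrank_range hbr hF⟩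
  · rintro _ ⟨F, rfl⟩
    by_cases hF : kirillovRank F = 0
    · simp [hF]
    · exact (eq_rank hF).le
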